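/- arXiv:2003.01626 — 6 statements merged into one kernel-verified Lean document; each statement's English description precedes it below -/
import Mathlib

section
/- Let p be a prime with p > 3. Then the group GL_2(ℤ_p) contains no element of order p; equivalently, every g ∈ GL_2(ℤ_p) with g^p = 1 satisfies g = 1. -/
open Polynomial

theorem Polynomial.cyclotomic_comp_X_add_one_irreducible_padic (p : ℕ) [hp : Fact p.Prime] :
    Irreducible (((cyclotomic p ℤ).comp (X + 1)).map (Int.castRingHom ℚ_[p])) := by
  have hE := cyclotomic_comp_X_add_one_isEisensteinAt p
  have hm : ((cyclotomic p ℤ).comp (X + 1)).Monic :=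
    (cyclotomic.monic p ℤ).comp_X_add_C 1
  have hd : ((cyclotomic p ℤ).comp (X + 1)).natDegree = p - 1 := by
    rw [← C_1, natDegree_comp, natDegree_X_add_C, natDegree_cyclotomic, mul_one,
      Nat.totient_prime hp.out]
  have h0 : ((cyclotomic p ℤ).comp (X + 1)).coeff 0 = p := by
    rw [coeff_zero_eq_eval_zero, eval_comp, eval_add, eval_X, eval_one, zero_add,
      eval_one_cyclotomic_prime]
  generalize (cyclotomic p ℤ).comp (X + 1) = f at *
  have hmZ := hm.map (Int.castRingHom ℤ_[p])
  have hdZ : (f.map (Int.castRingHom ℤ_[p])).natDegree = p - 1 := by rw [hm.natDegree_map, hd]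
  have hprime : (Ideal.span {(p : ℤ_[p])}).IsPrime :=
    (Ideal.span_singleton_prime PadicInt.prime_p.ne_zero).2 PadicInt.prime_p
  have hEis : (f.map (Int.castRingHom ℤ_[p])).IsEisensteinAt (Ideal.span {(p : ℤ_[p])}) := by
    refine ⟨?_, fun {n} hn => ?_, ?_⟩
    · rw [hmZ.leadingCoeff]
      exact fun h => hprime.ne_top ((Ideal.eq_top_iff_one _).2 h)
    · rw [hdZ, ← hd] at hn
      have h := hE.mem hn
      rw [Ideal.submodule_span_eq, Ideal.mem_span_singleton] at h
      rw [coeff_map, Ideal.mem_span_singleton]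
      simpa using (Int.castRingHom ℤ_[p]).map_dvd h
    · rw [coeff_map, h0, Ideal.span_singleton_pow, Ideal.mem_span_singleton]
      intro h
      apply (PadicInt.prime_p (p := p)).not_isUnit
      obtain ⟨c, hc⟩ := h
      refine IsUnit.of_mul_eq_one c (mul_left_cancel₀ (PadicInt.prime_p (p := p)).ne_zero ?_)
      simp only [map_natCast] at hc
      rw [← mul_assoc, ← sq, ← hc, mul_one]
  have hirr := hEis.irreducible hprime hmZ.isPrimitive
    (by rw [hdZ]; have := hp.out.two_le; omega)
  rw [hmZ.irreducible_iff_irreducible_map_fraction_map (K := ℚ_[p]), map_map] at hirr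
  rwa [RingHom.ext_int (Int.castRingHom ℚ_[p]) (_ : ℤ →+* ℚ_[p])]

theorem Matrix.eq_one_of_pow_prime_eq_one_padic (p : ℕ) [hpf : Fact p.Prime]
    {n : Type*} [Fintype n] [DecidableEq n] (hn : Fintype.card n < p - 1)
    (M : Matrix n n ℚ_[p]) (hM : M ^ p = 1) : M = 1 := by
  set f := ((cyclotomic p ℤ).comp (X + 1)).map (Int.castRingHom ℚ_[p]) with hf
  have hirr : Irreducible f := cyclotomic_comp_X_add_one_irreducible_padic p
  have hfd : f.natDegree = p - 1 := by
    rw [hf, ← C_1, ((cyclotomic.monic p ℤ).comp_X_add_C 1).natDegree_map, natDegree_comp,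
      natDegree_X_add_C, natDegree_cyclotomic, mul_one, Nat.totient_prime hpf.out]
  have hcop : IsCoprime f (M - 1).charpoly := by
    refine hirr.coprime_iff_not_dvd.2 fun h => ?_
    have := natDegree_le_of_dvd h (M - 1).charpoly_monic.ne_zero
    rw [Matrix.charpoly_natDegree_eq_dim, hfd] at this
    omega
  obtain ⟨a, b, hab⟩ := hcop
  have h1 := congrArg (aeval (M - 1)) hab
  rw [map_add, map_mul, map_mul, Matrix.aeval_self_charpoly, mul_zero, add_zero, map_one] at h1
  have h2 : aeval (M - 1) f * (M - 1) = 0 := by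
    have h : f * X = (X + 1) ^ p - 1 := by
      have := congrArg (fun q : ℤ[X] => (q.comp (X + 1)).map (Int.castRingHom ℚ_[p]))
        (cyclotomic_prime_mul_X_sub_one ℤ p)
      simpa [hf] using this
    simpa [hM] using congrArg (aeval (M - 1)) h
  refine sub_eq_zero.1 ?_
  calc M - 1 = aeval (M - 1) a * aeval (M - 1) f * (M - 1) := by rw [h1, one_mul]
    _ = 0 := by rw [mul_assoc, h2, mul_zero]

/-- For a prime `p > 3`, the group `GL₂(ℤ_p)` has no element of order `p`:
every `g` with `g ^ p = 1` is trivial. -/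
theorem GL2_Zp_no_p_torsion (p : ℕ) [Fact p.Prime] (hp : 3 < p)
    (g : GL (Fin 2) ℤ_[p]) (hg : g ^ p = 1) : g = 1 := by
  have hM : (g : Matrix (Fin 2) (Fin 2) ℤ_[p]) ^ p = 1 := by
    rw [← Units.val_pow_eq_pow_val, hg, Units.val_one]
  have h := Matrix.eq_one_of_pow_prime_eq_one_padic p
    (by rw [Fintype.card_fin]; omega)
    ((algebraMap ℤ_[p] ℚ_[p]).mapMatrix g.val) (by rw [← map_pow, hM, map_one])
  refine Units.ext (Matrix.map_injective (IsFractionRing.injective ℤ_[p] ℚ_[p]) ?_)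
  rw [← map_one (algebraMap ℤ_[p] ℚ_[p]).mapMatrix] at h
  exact h
end

section
/- Let p = 3 and let w ∈ GL_2(ℤ_3) be the matrix [[1, 1], [−3, −2]]. Then w³ = 1, w ≠ 1 (so w has order exactly 3), and the reduction of w modulo 3 is the upper unitriangular matrix [[1, 1], [0, 1]]. Consequently w lies in S, its image generates S/K_1 ≅ ℤ/3, and the extension 1 → K_1 → S → ℤ/3 → 1 splits. -/
open Matrix

/-- The subgroup of `GL₂(R)` of upper unitriangular matrices. -/
def unitriangular (R : Type*) [CommRing R] : Subgroup (GL (Fin 2) R) where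
  carrier := {g | (g : Matrix (Fin 2) (Fin 2) R) 0 0 = 1 ∧
    (g : Matrix (Fin 2) (Fin 2) R) 1 0 = 0 ∧ (g : Matrix (Fin 2) (Fin 2) R) 1 1 = 1}
  one_mem' := by simp
  mul_mem' := by
    rintro a b ⟨ha1, ha2, ha3⟩ ⟨hb1, hb2, hb3⟩
    refine ⟨?_, ?_, ?_⟩ <;>
      simp [Units.val_mul, Matrix.mul_apply, Fin.sum_univ_two, ha1, ha2, ha3, hb1, hb2, hb3]
  inv_mem' := by
    rintro a ⟨h1, h2, h3⟩
    have key : ((a : Matrix (Fin 2) (Fin 2) R) * ((a⁻¹ : GL (Fin 2) R) : Matrix (Fin 2) (Fin 2) R)) = 1 :=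
      a.mul_inv
    have e10 : ((a : Matrix (Fin 2) (Fin 2) R) * ((a⁻¹ : GL (Fin 2) R) : Matrix (Fin 2) (Fin 2) R)) 1 0
        = (1 : Matrix (Fin 2) (Fin 2) R) 1 0 := by rw [key]
    have e11 : ((a : Matrix (Fin 2) (Fin 2) R) * ((a⁻¹ : GL (Fin 2) R) : Matrix (Fin 2) (Fin 2) R)) 1 1
        = (1 : Matrix (Fin 2) (Fin 2) R) 1 1 := by rw [key]
    have e00 : ((a : Matrix (Fin 2) (Fin 2) R) * ((a⁻¹ : GL (Fin 2) R) : Matrix (Fin 2) (Fin 2) R)) 0 0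
        = (1 : Matrix (Fin 2) (Fin 2) R) 0 0 := by rw [key]
    simp only [Matrix.mul_apply, Fin.sum_univ_two, Matrix.one_apply_eq, Matrix.one_apply_ne,
      h1, h2, h3, zero_mul, one_mul, zero_add, add_zero, Ne, not_false_iff] at e10 e11 e00
    · refine ⟨?_, ?_, ?_⟩
      · simpa [e10] using e00
      · simpa using e10
      · simpa using e11

/-- Entrywise reduction mod `p` on `GL₂(ℤ_p)`. -/
noncomputable def redGL (p : ℕ) [Fact p.Prime] : GL (Fin 2) ℤ_[p] →* GL (Fin 2) (ZMod p) :=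
  Matrix.GeneralLinearGroup.map (PadicInt.toZMod)

/-- The Sylow pro-`p` subgroup `S` of `GL₂(ℤ_p)`: matrices whose reduction mod `p`
is upper unitriangular. -/
noncomputable def SylS (p : ℕ) [Fact p.Prime] : Subgroup (GL (Fin 2) ℤ_[p]) :=
  (unitriangular (ZMod p)).comap (redGL p)

/-- The first congruence subgroup `K₁`, the kernel of reduction mod `p`. -/
noncomputable def K₁ (p : ℕ) [Fact p.Prime] : Subgroup (GL (Fin 2) ℤ_[p]) :=
  (redGL p).ker

noncomputable instance (p : ℕ) [Fact p.Prime] : ((K₁ p).subgroupOf (SylS p)).Normal :=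
  Subgroup.Normal.subgroupOf (MonoidHom.normal_ker _) _

/-- The matrix `h = [[1,1],[0,1]]` as an element of `GL₂(ℤ_p)`. -/
noncomputable def hUnit (p : ℕ) [Fact p.Prime] : GL (Fin 2) ℤ_[p] :=
  ⟨!![1, 1; 0, 1], !![1, -1; 0, 1],
    by simp [Matrix.mul_fin_two, Matrix.one_fin_two],
    by simp [Matrix.mul_fin_two, Matrix.one_fin_two]⟩


/-- The matrix `w = [[1,1],[-3,-2]]` as an element of `GL₂(ℤ_3)`; its inverse is
`[[-2,-1],[3,1]]`. -/
noncomputable def wUnit : GL (Fin 2) ℤ_[3] :=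
  ⟨!![1, 1; -3, -2], !![-2, -1; 3, 1],
    by simp [Matrix.mul_fin_two, Matrix.one_fin_two]; norm_num,
    by simp [Matrix.mul_fin_two, Matrix.one_fin_two]; norm_num⟩

/-- If the class of `w` generates `G ⧸ N` and no nontrivial power of `w` lies in `N`, then the
quotient map `G → G ⧸ N` has a section. -/
theorem exists_section_of_zpowers_mk_eq_top {G : Type*} [Group G] (N : Subgroup G) [N.Normal]
    (w : G) (hgen : Subgroup.zpowers (w : G ⧸ N) = ⊤) (hN : ∀ n : ℤ, w ^ n ∈ N → w ^ n = 1) :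
    ∃ s : (G ⧸ N) →* G, (QuotientGroup.mk' N).comp s = MonoidHom.id _ := by
  let f : Subgroup.zpowers w →* G ⧸ N := (QuotientGroup.mk' N).comp (Subgroup.zpowers w).subtype
  have hf : Function.Bijective f := by
    constructor
    · rw [injective_iff_map_eq_one]
      rintro ⟨_, n, rfl⟩ h
      exact Subtype.ext (hN n ((QuotientGroup.eq_one_iff _).1 h))
    · intro x
      obtain ⟨n, hn⟩ := Subgroup.mem_zpowers_iff.1 (hgen ▸ Subgroup.mem_top x)
      exact ⟨⟨w ^ n, n, rfl⟩, hn⟩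
  refine ⟨(Subgroup.zpowers w).subtype.comp (MulEquiv.ofBijective f hf).symm.toMonoidHom, ?_⟩
  ext x
  exact (MulEquiv.ofBijective f hf).apply_symm_apply x

theorem wUnit_pow_three : wUnit ^ 3 = 1 := by
  ext i j
  fin_cases i <;> fin_cases j <;>
    simp [wUnit, pow_succ, Matrix.mul_apply, Fin.sum_univ_two] <;> norm_num

theorem coe_redGL_wUnit :
    (redGL 3 wUnit : Matrix (Fin 2) (Fin 2) (ZMod 3)) = !![1, 1; 0, 1] := by
  have h3 : PadicInt.toZMod (3 : ℤ_[3]) = 0 := map_ofNat PadicInt.toZMod 3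
  have h2 : -PadicInt.toZMod (2 : ℤ_[3]) = 1 := congrArg Neg.neg (map_ofNat PadicInt.toZMod 2)
  ext i j
  fin_cases i <;> fin_cases j <;> simp [redGL, wUnit, h3, h2]

theorem redGL_wUnit_ne_one : redGL 3 wUnit ≠ 1 := by
  intro h
  have h01 := congrArg (fun g : GL (Fin 2) (ZMod 3) => (g : Matrix (Fin 2) (Fin 2) (ZMod 3)) 0 1) h
  simp [coe_redGL_wUnit] at h01

theorem wUnit_mem_SylS : wUnit ∈ SylS 3 := by
  change _ ∧ _ ∧ _
  simp [coe_redGL_wUnit]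

theorem wUnit_zpow_eq_one_of_mem (n : ℤ) (h : wUnit ^ n ∈ K₁ 3) : wUnit ^ n = 1 := by
  have ho : orderOf (redGL 3 wUnit) = 3 :=
    orderOf_eq_prime (by rw [← map_pow, wUnit_pow_three, map_one]) redGL_wUnit_ne_one
  have h1 : redGL 3 wUnit ^ n = 1 := by rw [← map_zpow]; exact h
  obtain ⟨k, rfl⟩ := orderOf_dvd_iff_zpow_eq_one.2 h1
  rw [ho, _root_.zpow_mul, zpow_natCast, wUnit_pow_three, _root_.one_zpow]

theorem exists_redGL_wUnit_pow_eq {g : GL (Fin 2) (ZMod 3)} (hg : g ∈ unitriangular (ZMod 3)) :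
    ∃ n : ℕ, redGL 3 wUnit ^ n = g := by
  obtain ⟨h00, h10, h11⟩ := hg
  have key : ∀ b : ZMod 3, (!![1, 1; 0, 1] : Matrix (Fin 2) (Fin 2) (ZMod 3)) ^ b.val =
      !![1, b; 0, 1] := by decide
  refine ⟨((g : Matrix (Fin 2) (Fin 2) (ZMod 3)) 0 1).val, Units.ext ?_⟩
  rw [Units.val_pow_eq_pow_val, coe_redGL_wUnit, key]
  ext i j
  fin_cases i <;> fin_cases j <;> simp [h00, h10, h11]

theorem zpowers_mk_wUnit :
    Subgroup.zpowers
      ((QuotientGroup.mk (⟨wUnit, wUnit_mem_SylS⟩ : SylS 3)) :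
        SylS 3 ⧸ (K₁ 3).subgroupOf (SylS 3)) = ⊤ := by
  rw [eq_top_iff]
  rintro x -
  obtain ⟨g, rfl⟩ := QuotientGroup.mk_surjective x
  obtain ⟨n, hn⟩ := exists_redGL_wUnit_pow_eq g.2
  refine ⟨n, ?_⟩
  change ((QuotientGroup.mk _ : SylS 3 ⧸ (K₁ 3).subgroupOf (SylS 3)) ^ (n : ℤ)) = _
  rw [zpow_natCast, ← QuotientGroup.mk_pow, QuotientGroup.eq, Subgroup.mem_subgroupOf]
  change redGL 3 ((wUnit ^ n)⁻¹ * g) = 1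
  rw [map_mul, map_inv, map_pow, hn, inv_mul_cancel]

/-- For `p = 3`, the element `w = [[1,1],[-3,-2]] ∈ GL₂(ℤ_3)` satisfies `w³ = 1`, `w ≠ 1`,
its reduction mod 3 is `[[1,1],[0,1]]`; consequently `w ∈ S`, its image generates
`S/K₁ ≅ ℤ/3`, and the extension `1 → K₁ → S → ℤ/3 → 1` splits. -/
theorem wUnit_order_three_and_splitting :
    wUnit ^ 3 = 1 ∧ wUnit ≠ 1 ∧
      (redGL 3 wUnit : Matrix (Fin 2) (Fin 2) (ZMod 3)) = !![1, 1; 0, 1] ∧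
      ∃ wmem : wUnit ∈ SylS 3,
        Subgroup.zpowers
            ((QuotientGroup.mk (⟨wUnit, wmem⟩ : SylS 3)) :
              SylS 3 ⧸ (K₁ 3).subgroupOf (SylS 3)) = ⊤ ∧
        ∃ s : (SylS 3 ⧸ (K₁ 3).subgroupOf (SylS 3)) →* SylS 3,
          (QuotientGroup.mk' ((K₁ 3).subgroupOf (SylS 3))).comp s = MonoidHom.id _ := by
  refine ⟨wUnit_pow_three, fun h => redGL_wUnit_ne_one (by rw [h, map_one]), coe_redGL_wUnit,
    wUnit_mem_SylS, zpowers_mk_wUnit, exists_section_of_zpowers_mk_eq_top _ _ zpowers_mk_wUnit ?_⟩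
  intro n hn
  exact Subtype.ext (wUnit_zpow_eq_one_of_mem n hn)
end

section
/- Let p be a prime and i ≥ 1 an integer. The image of S under the reduction homomorphism GL_2(ℤ_p) → GL_2(ℤ/p^i ℤ) is a finite group of cardinality p^{4i−3}. In particular every such continuous finite quotient of S is a p-group. -/
open Matrix

/-- Every ring homomorphism `ℤ_p → ℤ/p` is the canonical reduction. -/
theorem PadicInt.ringHom_eq_toZMod {p : ℕ} [Fact p.Prime] (f : ℤ_[p] →+* ZMod p) :
    f = PadicInt.toZMod := by
  have hker : RingHom.ker f = IsLocalRing.maximalIdeal ℤ_[p] :=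
    IsLocalRing.eq_maximalIdeal
      (RingHom.ker_isMaximal_of_surjective f (ZMod.ringHom_surjective f))
  ext x
  have hx := PadicInt.toZMod_spec x
  rw [← hker, RingHom.mem_ker, map_sub, sub_eq_zero] at hx
  rw [hx, ZMod.cast_eq_val, map_natCast, ZMod.natCast_zmod_val]

theorem PadicInt.castHom_toZModPow {p : ℕ} [Fact p.Prime] {i : ℕ} (h : p ∣ p ^ i) (x : ℤ_[p]) :
    ZMod.castHom h (ZMod p) (PadicInt.toZModPow i x) = PadicInt.toZMod x :=
  RingHom.congr_fun
    (PadicInt.ringHom_eq_toZMod ((ZMod.castHom h (ZMod p)).comp (PadicInt.toZModPow i))) x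

theorem ZMod.card_ker_castHom_prime_pow {p : ℕ} [Fact p.Prime] {i : ℕ} (hi : 1 ≤ i)
    (h : p ∣ p ^ i) : Nat.card (RingHom.ker (ZMod.castHom h (ZMod p))) = p ^ (i - 1) := by
  set f := (ZMod.castHom h (ZMod p)).toAddMonoidHom
  have hf : Function.Surjective f := ZMod.ringHom_surjective (ZMod.castHom h (ZMod p))
  have hcard := AddSubgroup.card_mul_index f.ker
  rw [AddSubgroup.index_ker, AddMonoidHom.range_eq_top.2 hf, AddSubgroup.card_top,
    Nat.card_zmod, Nat.card_zmod] at hcard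
  have hp : 0 < p := (Fact.out : p.Prime).pos
  apply Nat.eq_of_mul_eq_mul_right hp
  rw [← pow_succ, Nat.sub_add_cancel hi]
  exact hcard

theorem mem_SylS_iff {p : ℕ} [Fact p.Prime] {g : GL (Fin 2) ℤ_[p]} :
    g ∈ SylS p ↔ PadicInt.toZMod (g 0 0) = 1 ∧ PadicInt.toZMod (g 1 0) = 0 ∧
      PadicInt.toZMod (g 1 1) = 1 :=
  Iff.rfl

/-- A matrix over `ℤ_p` whose reduction mod `p` is upper unitriangular lies in `S`. -/
theorem exists_mem_SylS {p : ℕ} [Fact p.Prime] {a b c d : ℤ_[p]}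
    (ha : PadicInt.toZMod a = 1) (hc : PadicInt.toZMod c = 0) (hd : PadicInt.toZMod d = 1) :
    ∃ g ∈ SylS p, (g : Matrix (Fin 2) (Fin 2) ℤ_[p]) = !![a, b; c, d] := by
  have hdet : IsUnit (!![a, b; c, d] : Matrix (Fin 2) (Fin 2) ℤ_[p]).det := by
    have := (ZMod.ringHom_surjective (PadicInt.toZMod (p := p))).isLocalHom
    apply isUnit_of_map_unit PadicInt.toZMod
    simp [Matrix.det_fin_two, ha, hc, hd]
  refine ⟨Matrix.GeneralLinearGroup.mk'' _ hdet, ?_, rfl⟩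
  exact mem_SylS_iff.2 ⟨ha, hc, hd⟩

/-- The image of `S` in `GL₂(ℤ/p^i)` consists of the matrices whose reduction mod `p` is upper
unitriangular. -/
theorem mem_map_SylS_iff {p : ℕ} [Fact p.Prime] {i : ℕ} (h : p ∣ p ^ i)
    {g : GL (Fin 2) (ZMod (p ^ i))} :
    g ∈ (SylS p).map (Matrix.GeneralLinearGroup.map (n := Fin 2) (PadicInt.toZModPow (p := p) i)) ↔
      ZMod.castHom h (ZMod p) (g 0 0) = 1 ∧ ZMod.castHom h (ZMod p) (g 1 0) = 0 ∧
        ZMod.castHom h (ZMod p) (g 1 1) = 1 := by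
  constructor
  · rintro ⟨s, hs, rfl⟩
    simpa only [Matrix.GeneralLinearGroup.map_apply, PadicInt.castHom_toZModPow] using
      mem_SylS_iff.1 hs
  · rintro ⟨ha, hc, hd⟩
    have hsurj := ZMod.ringHom_surjective (PadicInt.toZModPow (p := p) i)
    obtain ⟨a, ea⟩ := hsurj (g 0 0)
    obtain ⟨b, eb⟩ := hsurj (g 0 1)
    obtain ⟨c, ec⟩ := hsurj (g 1 0)
    obtain ⟨d, ed⟩ := hsurj (g 1 1)
    rw [← ea, PadicInt.castHom_toZModPow] at ha
    rw [← ec, PadicInt.castHom_toZModPow] at hc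
    rw [← ed, PadicInt.castHom_toZModPow] at hd
    obtain ⟨s, hs, es⟩ := exists_mem_SylS (b := b) ha hc hd
    refine ⟨s, hs, ?_⟩
    ext r t
    rw [Matrix.GeneralLinearGroup.map_apply, es]
    fin_cases r <;> fin_cases t <;> assumption

/-- Entries give a bijection from the image of `S` in `GL₂(ℤ/p^i)` to
`I × ℤ/p^i × I × I`, where `I` is the kernel of `ℤ/p^i → ℤ/p`. -/
theorem card_map_SylS_eq {p : ℕ} [Fact p.Prime] {i : ℕ} (h : p ∣ p ^ i) :
    Nat.card ((SylS p).map
        (Matrix.GeneralLinearGroup.map (n := Fin 2) (PadicInt.toZModPow (p := p) i))) =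
      Nat.card (RingHom.ker (ZMod.castHom h (ZMod p)) × ZMod (p ^ i) ×
        RingHom.ker (ZMod.castHom h (ZMod p)) × RingHom.ker (ZMod.castHom h (ZMod p))) := by
  have hmem := @mem_map_SylS_iff p _ i h
  refine Nat.card_eq_of_bijective (fun g =>
    (⟨g.1 0 0 - 1, by rw [RingHom.mem_ker, map_sub, (hmem.1 g.2).1, map_one, sub_self]⟩, g.1 0 1,
      ⟨g.1 1 0, (hmem.1 g.2).2.1⟩,
      ⟨g.1 1 1 - 1, by rw [RingHom.mem_ker, map_sub, (hmem.1 g.2).2.2, map_one, sub_self]⟩))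
    ⟨?_, ?_⟩
  · rintro g g' e
    simp only [Prod.mk.injEq, Subtype.mk.injEq, sub_left_inj] at e
    obtain ⟨ha, hb, hc, hd⟩ := e
    replace hc := congrArg Subtype.val hc
    ext r t
    fin_cases r <;> fin_cases t <;> assumption
  · rintro ⟨⟨x, hx⟩, b, ⟨z, hz⟩, ⟨w, hw⟩⟩
    have hsurj := ZMod.ringHom_surjective (PadicInt.toZModPow (p := p) i)
    obtain ⟨x, rfl⟩ := hsurj x
    obtain ⟨b, rfl⟩ := hsurj b
    obtain ⟨z, rfl⟩ := hsurj z
    obtain ⟨w, rfl⟩ := hsurj w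
    rw [RingHom.mem_ker, PadicInt.castHom_toZModPow] at hx hz hw
    obtain ⟨s, hs, es⟩ := exists_mem_SylS (a := x + 1) (b := b) (d := w + 1)
      (by simp [hx]) hz (by simp [hw])
    refine ⟨⟨_, Subgroup.mem_map_of_mem _ hs⟩, ?_⟩
    simp [Matrix.GeneralLinearGroup.map_apply, es]

/-- The image of the Sylow pro-`p` subgroup `S` under reduction mod `p^i` (`i ≥ 1`) is a
finite group of cardinality `p^(4i-3)`; in particular it is a `p`-group. -/
theorem SylS_image_card (p : ℕ) [Fact p.Prime] (i : ℕ) (hi : 1 ≤ i) :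
    Nat.card
        (Subgroup.map (Matrix.GeneralLinearGroup.map (n := Fin 2) (PadicInt.toZModPow (p := p) i))
          (SylS p)) = p ^ (4 * i - 3) ∧
      IsPGroup p
        (Subgroup.map (Matrix.GeneralLinearGroup.map (n := Fin 2) (PadicInt.toZModPow (p := p) i))
          (SylS p)) := by
  have hcard : Nat.card (Subgroup.map
      (Matrix.GeneralLinearGroup.map (n := Fin 2) (PadicInt.toZModPow (p := p) i)) (SylS p)) =
      p ^ (4 * i - 3) := by
    have h : p ∣ p ^ i := dvd_pow_self p (by lia)
    rw [card_map_SylS_eq h]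
    simp only [Nat.card_prod, ZMod.card_ker_castHom_prime_pow hi h, Nat.card_zmod, ← pow_add]
    congr 1
    lia
  exact ⟨hcard, IsPGroup.of_card hcard⟩
end

section
/- Let p = 3, and let h = [[1, 1], [0, 1]] and l = [[1, 0], [1, 1]] in GL_2(𝔽_3). Every alternating bilinear form f : M_2(𝔽_3) × M_2(𝔽_3) → 𝔽_3 satisfying f(h A h⁻¹, h B h⁻¹) = f(A, B) and f(l A l⁻¹, l B l⁻¹) = f(A, B) for all A, B ∈ M_2(𝔽_3) is identically zero. -/
open Matrix

/-- Every alternating bilinear form on `M₂(𝔽₃)` invariant under conjugation by both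
`h = [[1,1],[0,1]]` and `l = [[1,0],[1,1]]` is identically zero. -/
theorem invariant_alternating_bilinear_eq_zero
    (f : Matrix (Fin 2) (Fin 2) (ZMod 3) →ₗ[ZMod 3]
          (Matrix (Fin 2) (Fin 2) (ZMod 3) →ₗ[ZMod 3] ZMod 3))
    (halt : ∀ A, f A A = 0)
    (hh : ∀ A B, f (!![1, 1; 0, 1] * A * !![1, -1; 0, 1])
            (!![1, 1; 0, 1] * B * !![1, -1; 0, 1]) = f A B)
    (hl : ∀ A B, f (!![1, 0; 1, 1] * A * !![1, 0; -1, 1])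
            (!![1, 0; 1, 1] * B * !![1, 0; -1, 1]) = f A B) :
    f = 0 := by
  have skew : ∀ A B, f B A = -f A B := fun A B => (LinearMap.IsAlt.neg halt A B).symm
  -- `M₂(𝔽₃)` is the sum of the scalars and `sl₂`, the latter with basis `D`, `E`, `F`.
  obtain ⟨D, hD⟩ : ∃ D : Matrix (Fin 2) (Fin 2) (ZMod 3), D = !![1, 0; 0, -1] := ⟨_, rfl⟩
  obtain ⟨E, hE⟩ : ∃ E : Matrix (Fin 2) (Fin 2) (ZMod 3), E = !![0, 1; 0, 0] := ⟨_, rfl⟩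
  obtain ⟨F, hF⟩ : ∃ F : Matrix (Fin 2) (Fin 2) (ZMod 3), F = !![0, 0; 1, 0] := ⟨_, rfl⟩
  have h_one : !![1, 1; 0, 1] * 1 * !![1, -1; 0, 1] = (1 : Matrix _ _ (ZMod 3)) := by decide
  have h_D : !![1, 1; 0, 1] * D * !![1, -1; 0, 1] = D + E := by subst hD hE; decide
  have h_E : !![1, 1; 0, 1] * E * !![1, -1; 0, 1] = E := by subst hE; decide
  have h_F : !![1, 1; 0, 1] * F * !![1, -1; 0, 1] = F + D - E := by
    subst hD hE hF; decide
  have l_one : !![1, 0; 1, 1] * 1 * !![1, 0; -1, 1] = (1 : Matrix _ _ (ZMod 3)) := by decide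
  have l_D : !![1, 0; 1, 1] * D * !![1, 0; -1, 1] = D - F := by subst hD hF; decide
  have l_E : !![1, 0; 1, 1] * E * !![1, 0; -1, 1] = E - D - F := by
    subst hD hE hF; decide
  have l_F : !![1, 0; 1, 1] * F * !![1, 0; -1, 1] = F := by subst hF; decide
  have one_E : f 1 E = 0 := by
    have := hh 1 D
    rw [h_one, h_D] at this
    simpa using this
  have one_D : f 1 D = 0 := by
    have := hh 1 F
    rw [h_one, h_F] at this
    simpa [one_E] using this
  have one_F : f 1 F = 0 := by
    have := hl 1 D
    rw [l_one, l_D] at this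
    simpa using this
  have E_D : f E D = 0 := by
    have := hh E F
    rw [h_E, h_F] at this
    simpa [halt] using this
  have D_F : f D F = 0 := by
    have := hl E F
    rw [l_E, l_F] at this
    simpa [halt] using this
  have E_F : f E F = 0 := by
    have := hh D F
    rw [h_D, h_F] at this
    simpa [halt, skew E D, E_D, D_F] using this
  have decomp : ∀ A : Matrix (Fin 2) (Fin 2) (ZMod 3),
      A = (-(A 0 0 + A 1 1)) • 1 + (A 1 1 - A 0 0) • D + A 0 1 • E + A 1 0 • F := by
    have two : ∀ x y : ZMod 3, x = -y + -x + (y - x) ∧ y = -y + -x + (x - y) := by decide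
    intro A
    ext i j
    fin_cases i <;> fin_cases j <;> simp [hD, hE, hF]
    exacts [(two _ _).1, (two _ _).2]
  refine LinearMap.ext₂ fun A B => ?_
  rw [decomp A, decomp B]
  simp [halt, one_D, one_E, one_F, E_D, E_F, D_F, skew 1 D, skew 1 E, skew 1 F, skew E D,
    skew E F, skew D F]
end

section
/- Let p = 3, and let h = [[1, 1], [0, 1]] and l = [[1, 0], [1, 1]] in GL_2(𝔽_3). The space of alternating trilinear forms f : M_2(𝔽_3)³ → 𝔽_3 satisfying f(h A h⁻¹, h B h⁻¹, h C h⁻¹) = f(A, B, C) and f(l A l⁻¹, l B l⁻¹, l C l⁻¹) = f(A, B, C) for all A, B, C ∈ M_2(𝔽_3) is one-dimensional (spanned by the form corresponding to y_{11}∧y_{12}∧y_{21} − y_{12}∧y_{21}∧y_{22}, where y_{ij} denotes the (i,j)-entry functional). -/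
open Matrix

/-- The alternating trilinear form on `2 × 2` matrices given by the determinant of the three
matrix entries at the positions `p 0`, `p 1`, `p 2`. -/
def entryDetForm (R : Type*) [CommRing R] (p : Fin 3 → Fin 2 × Fin 2) :
    (Matrix (Fin 2) (Fin 2) R) [⋀^(Fin 3)]→ₗ[R] R :=
  Matrix.detRowAlternating.compLinearMap
    (LinearMap.pi fun j => Matrix.entryLinearMap R R (p j).1 (p j).2)

theorem entryDetForm_apply {R : Type*} [CommRing R] (p : Fin 3 → Fin 2 × Fin 2)
    (v : Fin 3 → Matrix (Fin 2) (Fin 2) R) :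
    entryDetForm R p v = Matrix.det (Matrix.of fun i j => v i (p j).1 (p j).2) :=
  rfl

/-- An injective triple of matrix positions is a permutation of one of the four increasing ones. -/
theorem exists_perm_of_injective_positions (v : Fin 3 → Fin 2 × Fin 2)
    (hv : Function.Injective v) :
    ∃ σ : Equiv.Perm (Fin 3),
      v ∘ σ = ![(0, 0), (0, 1), (1, 0)] ∨ v ∘ σ = ![(0, 0), (0, 1), (1, 1)] ∨
      v ∘ σ = ![(0, 0), (1, 0), (1, 1)] ∨ v ∘ σ = ![(0, 1), (1, 0), (1, 1)] := by
  revert v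
  decide

/-- An alternating trilinear form on `2 × 2` matrices invariant under conjugation by the two
elementary unipotent matrices vanishes as soon as it vanishes on `(E₁₁, E₁₂, E₂₁)`. -/
theorem eq_zero_of_invariant_of_apply_eq_zero {R : Type*} [CommRing R]
    (g : (Matrix (Fin 2) (Fin 2) R) [⋀^(Fin 3)]→ₗ[R] R)
    (hh : ∀ v, g (fun k => !![1, 1; 0, 1] * v k * !![1, -1; 0, 1]) = g v)
    (hl : ∀ v, g (fun k => !![1, 0; 1, 1] * v k * !![1, 0; -1, 1]) = g v)
    (h₀ : g ![!![1, 0; 0, 0], !![0, 1; 0, 0], !![0, 0; 1, 0]] = 0) : g = 0 := by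
  have add₁ (a a' b c) : g ![a + a', b, c] = g ![a, b, c] + g ![a', b, c] :=
    g.map_vecCons_add ![b, c] a a'
  have swap₁ (a b c) : g ![b, a, c] = -g ![a, b, c] := by
    rw [← g.map_swap ![a, b, c] (show (0 : Fin 3) ≠ 1 by decide)]
    congr 1; ext i : 1; fin_cases i <;> rfl
  have swap₂ (a b c) : g ![a, c, b] = -g ![a, b, c] := by
    rw [← g.map_swap ![a, b, c] (show (1 : Fin 3) ≠ 2 by decide)]
    congr 1; ext i : 1; fin_cases i <;> rfl
  have add₂ (a b b' c) : g ![a, b + b', c] = g ![a, b, c] + g ![a, b', c] := by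
    rw [swap₁, add₁, swap₁ a b, swap₁ a b']; ring
  have add₃ (a b c c') : g ![a, b, c + c'] = g ![a, b, c] + g ![a, b, c'] := by
    rw [swap₂, add₂, swap₂ a b c, swap₂ a b c']; ring
  have neg₁ (a b c) : g ![-a, b, c] = -g ![a, b, c] := by
    simpa using g.map_vecCons_smul ![b, c] (-1) a
  have neg₂ (a b c) : g ![a, -b, c] = -g ![a, b, c] := by
    rw [swap₁, neg₁, swap₁ a b, neg_neg]
  have neg₃ (a b c) : g ![a, b, -c] = -g ![a, b, c] := by
    rw [swap₂, neg₂, swap₂ a b c, neg_neg]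
  have self₁ (a c) : g ![a, a, c] = 0 :=
    g.map_eq_zero_of_eq _ (i := 0) (j := 1) rfl (by decide)
  have self₂ (a b) : g ![a, b, b] = 0 :=
    g.map_eq_zero_of_eq _ (i := 1) (j := 2) rfl (by decide)
  have self₃ (a b) : g ![a, b, a] = 0 :=
    g.map_eq_zero_of_eq _ (i := 0) (j := 2) rfl (by decide)
  have hh' (a b c) : g ![!![1, 1; 0, 1] * a * !![1, -1; 0, 1],
      !![1, 1; 0, 1] * b * !![1, -1; 0, 1], !![1, 1; 0, 1] * c * !![1, -1; 0, 1]] =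
      g ![a, b, c] := by
    rw [← hh ![a, b, c]]
    congr 1; ext i : 1; fin_cases i <;> rfl
  have hl' (a b c) : g ![!![1, 0; 1, 1] * a * !![1, 0; -1, 1],
      !![1, 0; 1, 1] * b * !![1, 0; -1, 1], !![1, 0; 1, 1] * c * !![1, 0; -1, 1]] =
      g ![a, b, c] := by
    rw [← hl ![a, b, c]]
    congr 1; ext i : 1; fin_cases i <;> rfl
  obtain ⟨p, hp⟩ : ∃ p : Matrix (Fin 2) (Fin 2) R, p = !![1, 0; 0, 0] := ⟨_, rfl⟩
  obtain ⟨q, hq⟩ : ∃ q : Matrix (Fin 2) (Fin 2) R, q = !![0, 1; 0, 0] := ⟨_, rfl⟩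
  obtain ⟨r, hr⟩ : ∃ r : Matrix (Fin 2) (Fin 2) R, r = !![0, 0; 1, 0] := ⟨_, rfl⟩
  obtain ⟨s, hs⟩ : ∃ s : Matrix (Fin 2) (Fin 2) R, s = !![0, 0; 0, 1] := ⟨_, rfl⟩
  have hp_h : !![1, 1; 0, 1] * p * !![1, -1; 0, 1] = p + -q := by
    ext i j; fin_cases i <;> fin_cases j <;> simp [hp, hq]
  have hq_h : !![1, 1; 0, 1] * q * !![1, -1; 0, 1] = q := by
    ext i j; fin_cases i <;> fin_cases j <;> simp [hq]
  have hr_h : !![1, 1; 0, 1] * r * !![1, -1; 0, 1] = p + -q + r + -s := by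
    ext i j; fin_cases i <;> fin_cases j <;> simp [hp, hq, hr, hs]
  have hs_h : !![1, 1; 0, 1] * s * !![1, -1; 0, 1] = q + s := by
    ext i j; fin_cases i <;> fin_cases j <;> simp [hq, hs]
  have hp_l : !![1, 0; 1, 1] * p * !![1, 0; -1, 1] = p + r := by
    ext i j; fin_cases i <;> fin_cases j <;> simp [hp, hr]
  have hq_l : !![1, 0; 1, 1] * q * !![1, 0; -1, 1] = -p + q + -r + s := by
    ext i j; fin_cases i <;> fin_cases j <;> simp [hp, hq, hr, hs]
  have hr_l : !![1, 0; 1, 1] * r * !![1, 0; -1, 1] = r := by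
    ext i j; fin_cases i <;> fin_cases j <;> simp [hr]
  rw [← hp, ← hq, ← hr] at h₀
  have h₁ : g ![p, q, s] = 0 := by
    have h := hh' p q r
    rw [hp_h, hq_h, hr_h] at h
    simpa [add₁, add₃, neg₁, neg₃, self₁, self₂, self₃, h₀] using h
  have h₂ : g ![p, r, s] = 0 := by
    have h := hl' p q r
    rw [hp_l, hq_l, hr_l] at h
    simpa [add₁, add₂, neg₂, self₁, self₂, self₃, h₀, swap₁ p r, swap₂ p r s] using h
  have h₃ : g ![q, r, s] = 0 := by
    have h := hh' p r s
    rw [hp_h, hr_h, hs_h] at h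
    simpa [add₁, add₂, add₃, neg₁, neg₂, neg₃, self₁, self₂, self₃, h₀, h₁, h₂,
      swap₁ p q, swap₂ p q r, swap₂ p q s] using h
  refine Module.Basis.ext_alternating (Matrix.stdBasis R (Fin 2) (Fin 2)) fun v hv => ?_
  have hb₀ : Matrix.stdBasis R (Fin 2) (Fin 2) (0, 0) = p := by
    ext i j; fin_cases i <;> fin_cases j <;> simp [Matrix.stdBasis_eq_single, hp]
  have hb₁ : Matrix.stdBasis R (Fin 2) (Fin 2) (0, 1) = q := by
    ext i j; fin_cases i <;> fin_cases j <;> simp [Matrix.stdBasis_eq_single, hq]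
  have hb₂ : Matrix.stdBasis R (Fin 2) (Fin 2) (1, 0) = r := by
    ext i j; fin_cases i <;> fin_cases j <;> simp [Matrix.stdBasis_eq_single, hr]
  have hb₃ : Matrix.stdBasis R (Fin 2) (Fin 2) (1, 1) = s := by
    ext i j; fin_cases i <;> fin_cases j <;> simp [Matrix.stdBasis_eq_single, hs]
  have hb_comp (x y z) : Matrix.stdBasis R (Fin 2) (Fin 2) ∘ ![x, y, z] =
      ![Matrix.stdBasis R (Fin 2) (Fin 2) x, Matrix.stdBasis R (Fin 2) (Fin 2) y,
        Matrix.stdBasis R (Fin 2) (Fin 2) z] := by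
    ext i : 1; fin_cases i <;> rfl
  obtain ⟨σ, hσ⟩ := exists_perm_of_injective_positions v hv
  have key : g ((Matrix.stdBasis R (Fin 2) (Fin 2)) ∘ (v ∘ σ)) = 0 := by
    rcases hσ with hσ | hσ | hσ | hσ <;>
      simp only [hσ, hb_comp, hb₀, hb₁, hb₂, hb₃,
        h₀, h₁, h₂, h₃]
  rw [← Function.comp_assoc, g.map_perm] at key
  exact (smul_eq_zero_iff_eq _).1 key

/-- The space of alternating trilinear forms on `M₂(𝔽₃)` invariant under conjugation by
both `h = [[1,1],[0,1]]` and `l = [[1,0],[1,1]]` is one-dimensional, spanned by the form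
`y₁₁ ∧ y₁₂ ∧ y₂₁ − y₁₂ ∧ y₂₁ ∧ y₂₂` (where `y i j` is the `(i,j)`-entry functional). -/
theorem invariant_alternating_trilinear_one_dimensional :
    ∃ f₀ : (Matrix (Fin 2) (Fin 2) (ZMod 3)) [⋀^(Fin 3)]→ₗ[ZMod 3] (ZMod 3),
      f₀ ≠ 0 ∧
      (∀ v : Fin 3 → Matrix (Fin 2) (Fin 2) (ZMod 3),
        f₀ v = Matrix.det !![v 0 0 0, v 0 0 1, v 0 1 0;
                            v 1 0 0, v 1 0 1, v 1 1 0;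
                            v 2 0 0, v 2 0 1, v 2 1 0] -
               Matrix.det !![v 0 0 1, v 0 1 0, v 0 1 1;
                            v 1 0 1, v 1 1 0, v 1 1 1;
                            v 2 0 1, v 2 1 0, v 2 1 1]) ∧
      (∀ v : Fin 3 → Matrix (Fin 2) (Fin 2) (ZMod 3),
        f₀ (fun k => !![1, 1; 0, 1] * v k * !![1, -1; 0, 1]) = f₀ v) ∧
      (∀ v : Fin 3 → Matrix (Fin 2) (Fin 2) (ZMod 3),
        f₀ (fun k => !![1, 0; 1, 1] * v k * !![1, 0; -1, 1]) = f₀ v) ∧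
      ∀ f : (Matrix (Fin 2) (Fin 2) (ZMod 3)) [⋀^(Fin 3)]→ₗ[ZMod 3] (ZMod 3),
        (∀ v : Fin 3 → Matrix (Fin 2) (Fin 2) (ZMod 3),
          f (fun k => !![1, 1; 0, 1] * v k * !![1, -1; 0, 1]) = f v) →
        (∀ v : Fin 3 → Matrix (Fin 2) (Fin 2) (ZMod 3),
          f (fun k => !![1, 0; 1, 1] * v k * !![1, 0; -1, 1]) = f v) →
        ∃ c : ZMod 3, f = c • f₀ := by
  have apply_eq (v : Fin 3 → Matrix (Fin 2) (Fin 2) (ZMod 3)) :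
      (entryDetForm (ZMod 3) ![(0, 0), (0, 1), (1, 0)] -
        entryDetForm (ZMod 3) ![(0, 1), (1, 0), (1, 1)]) v =
        Matrix.det !![v 0 0 0, v 0 0 1, v 0 1 0;
                      v 1 0 0, v 1 0 1, v 1 1 0;
                      v 2 0 0, v 2 0 1, v 2 1 0] -
        Matrix.det !![v 0 0 1, v 0 1 0, v 0 1 1;
                      v 1 0 1, v 1 1 0, v 1 1 1;
                      v 2 0 1, v 2 1 0, v 2 1 1] := by
    simp [entryDetForm_apply, Matrix.det_fin_three]
  generalize entryDetForm (ZMod 3) ![(0, 0), (0, 1), (1, 0)] -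
    entryDetForm (ZMod 3) ![(0, 1), (1, 0), (1, 1)] = f₀ at apply_eq
  have apply_basis : f₀ ![!![1, 0; 0, 0], !![0, 1; 0, 0], !![0, 0; 1, 0]] = 1 := by
    simp [apply_eq, Matrix.det_fin_three]
  have inv_h (v : Fin 3 → Matrix (Fin 2) (Fin 2) (ZMod 3)) :
      f₀ (fun k => !![1, 1; 0, 1] * v k * !![1, -1; 0, 1]) = f₀ v := by
    simp only [apply_eq, Matrix.det_fin_three, Matrix.mul_apply, Fin.sum_univ_two]
    simp
    ring
  have inv_l (v : Fin 3 → Matrix (Fin 2) (Fin 2) (ZMod 3)) :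
      f₀ (fun k => !![1, 0; 1, 1] * v k * !![1, 0; -1, 1]) = f₀ v := by
    simp only [apply_eq, Matrix.det_fin_three, Matrix.mul_apply, Fin.sum_univ_two]
    simp
    ring
  refine ⟨f₀, ?_, apply_eq, inv_h, inv_l, fun f hf_h hf_l => ?_⟩
  · rintro rfl
    simp at apply_basis
  · refine ⟨f ![!![1, 0; 0, 0], !![0, 1; 0, 0], !![0, 0; 1, 0]], sub_eq_zero.1 ?_⟩
    apply eq_zero_of_invariant_of_apply_eq_zero
    · intro v
      simp only [AlternatingMap.sub_apply, AlternatingMap.smul_apply, hf_h, inv_h]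
    · intro v
      simp only [AlternatingMap.sub_apply, AlternatingMap.smul_apply, hf_l, inv_l]
    · simp [apply_basis]
end

section
/- Let Q = {g ∈ GL_2(ℤ/9ℤ) : the reduction of g modulo 3 is upper unitriangular, i.e. g ≡ (1 *; 0 1) mod 3}. Then Q is a group of order 3⁵ = 243 and Q is isomorphic to ((ℤ/3 × ℤ/3 × ℤ/3) ⋊ ℤ/3) × ℤ/3, where ℤ/3 acts on ℤ/3 × ℤ/3 × ℤ/3 by cyclically permuting the three coordinates; that is, Q ≅ (ℤ/3 ≀ ℤ/3) × ℤ/3, the direct product of the regular wreath product ℤ/3 ≀ ℤ/3 with ℤ/3. -/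
open Matrix

/-- The subgroup `Q` of `GL₂(ℤ/9)` of matrices whose reduction mod 3 is upper
unitriangular. -/
def Qgrp : Subgroup (GL (Fin 2) (ZMod 9)) :=
  (unitriangular (ZMod 3)).comap
    (Matrix.GeneralLinearGroup.map (ZMod.castHom (show (3 : ℕ) ∣ 9 by norm_num) (ZMod 3)))

/-- The additive embedding `ℤ/3 → ℤ/9`, `a ↦ 3 a`. -/
def threeMul (a : ZMod 3) : ZMod 9 := 3 * (a.val : ZMod 9)

lemma threeMul_zero : threeMul 0 = 0 := by decide

lemma threeMul_add (a b : ZMod 3) : threeMul (a + b) = threeMul a + threeMul b := by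
  decide +revert

lemma threeMul_mul (a b : ZMod 3) : threeMul a * threeMul b = 0 := by
  decide +revert

lemma castHom_threeMul (a : ZMod 3) :
    ZMod.castHom (show (3 : ℕ) ∣ 9 by norm_num) (ZMod 3) (threeMul a) = 0 := by
  decide +revert

/-- The matrix `1 + 3 ∑ⱼ f j • u⁻ʲ E₂₁ uʲ`, where `u` is the elementary unipotent matrix. -/
def traceZeroMatrix (f : ZMod 3 → ZMod 3) : Matrix (Fin 2) (Fin 2) (ZMod 9) :=
  !![1 + threeMul (f 2 - f 1), threeMul (-f 1 - f 2);
    threeMul (f 0 + f 1 + f 2), 1 + threeMul (f 1 - f 2)]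

/-- The powers of `!![1, 1; -3, -2]`, a matrix of order three. -/
def orderThreeMatrix (z : ZMod 3) : Matrix (Fin 2) (Fin 2) (ZMod 9) :=
  !![1, 1; -3, -2] ^ z.val

/-- The scalar `1 + 3 c`. -/
def scalarUnit (c : ZMod 3) : ZMod 9 := 1 + threeMul c

lemma traceZeroMatrix_zero : traceZeroMatrix 0 = 1 := by decide

lemma traceZeroMatrix_add (f g : ZMod 3 → ZMod 3) :
    traceZeroMatrix (f + g) = traceZeroMatrix f * traceZeroMatrix g := by
  have sub_eq (a b : ZMod 3) : threeMul (a - b) = threeMul a - threeMul b := by decide +revert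
  have neg_eq (a : ZMod 3) : threeMul (-a) = -threeMul a := by decide +revert
  ext i j
  fin_cases i <;> fin_cases j <;>
    simp [traceZeroMatrix, Matrix.mul_apply, Fin.sum_univ_two, threeMul_add, sub_eq, neg_eq] <;>
    ring_nf <;> simp [threeMul_mul]

lemma orderThreeMatrix_zero : orderThreeMatrix 0 = 1 := by decide

lemma orderThreeMatrix_add (y z : ZMod 3) :
    orderThreeMatrix (y + z) = orderThreeMatrix y * orderThreeMatrix z := by
  decide +revert

lemma scalarUnit_add (a b : ZMod 3) : scalarUnit (a + b) = scalarUnit a * scalarUnit b := by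
  decide +revert

lemma orderThreeMatrix_mul_traceZeroMatrix (z : ZMod 3) (f : ZMod 3 → ZMod 3) :
    orderThreeMatrix z * traceZeroMatrix f =
      traceZeroMatrix (fun i => f (i + z)) * orderThreeMatrix z := by
  have key : ∀ z a b c : ZMod 3,
      orderThreeMatrix z * traceZeroMatrix ![a, b, c] =
        traceZeroMatrix (fun i => (![a, b, c] : ZMod 3 → ZMod 3) (i + z)) *
          orderThreeMatrix z := by
    decide +kernel
  have hf : f = ![f 0, f 1, f 2] := by
    funext i
    fin_cases i <;> rfl
  rw [hf]
  exact key z _ _ _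

/-- The cyclic shift action of `ℤ/3` on `(ℤ/3)³`. -/
def cyclicShift : Multiplicative (ZMod 3) →* MulAut (Multiplicative (ZMod 3 → ZMod 3)) where
  toFun z :=
    { toFun f := Multiplicative.ofAdd fun i => f.toAdd (i + z.toAdd)
      invFun f := Multiplicative.ofAdd fun i => f.toAdd (i - z.toAdd)
      left_inv f := by
        apply Multiplicative.toAdd.injective
        funext i
        simp
      right_inv f := by
        apply Multiplicative.toAdd.injective
        funext i
        simp
      map_mul' _ _ := rfl }
  map_one' := by
    ext f : 1
    apply Multiplicative.toAdd.injective
    funext i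
    simp
  map_mul' y z := by
    ext f : 1
    apply Multiplicative.toAdd.injective
    funext i
    simp [add_assoc]

/-- The matrix representation of `(ℤ/3 ≀ ℤ/3) × ℤ/3` over `ℤ/9`. -/
def wreathProdToMatrix :
    (Multiplicative (ZMod 3 → ZMod 3) ⋊[cyclicShift] Multiplicative (ZMod 3)) ×
      Multiplicative (ZMod 3) →* Matrix (Fin 2) (Fin 2) (ZMod 9) where
  toFun x := scalarUnit x.2.toAdd •
    (traceZeroMatrix x.1.left.toAdd * orderThreeMatrix x.1.right.toAdd)
  map_one' := by
    simp [traceZeroMatrix_zero, orderThreeMatrix_zero, scalarUnit, threeMul_zero]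
  map_mul' x y := by
    have h := orderThreeMatrix_mul_traceZeroMatrix x.1.right.toAdd y.1.left.toAdd
    have e : (cyclicShift x.1.right y.1.left).toAdd =
      fun i => y.1.left.toAdd (i + x.1.right.toAdd) := rfl
    simp only [Prod.fst_mul, Prod.snd_mul, SemidirectProduct.mul_left,
      SemidirectProduct.mul_right, toAdd_mul, scalarUnit_add, traceZeroMatrix_add,
      orderThreeMatrix_add, e, smul_mul_assoc, mul_smul_comm, smul_smul]
    rw [mul_comm (scalarUnit y.2.toAdd), Matrix.mul_assoc, Matrix.mul_assoc,
      ← Matrix.mul_assoc (traceZeroMatrix _) (orderThreeMatrix _), ← h]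
    simp only [Matrix.mul_assoc]

lemma wreathProdToMatrix_injective : Function.Injective wreathProdToMatrix := by
  have key : ∀ z c a₀ a₁ a₂ : ZMod 3,
      scalarUnit c • (traceZeroMatrix ![a₀, a₁, a₂] * orderThreeMatrix z) = 1 →
        z = 0 ∧ c = 0 ∧ a₀ = 0 ∧ a₁ = 0 ∧ a₂ = 0 := by
    decide +kernel
  have hinj : Function.Injective wreathProdToMatrix.toHomUnits := by
    rw [injective_iff_map_eq_one]
    rintro ⟨⟨f, z⟩, c⟩ h
    obtain ⟨hz, hc, h₀, h₁, h₂⟩ := key z.toAdd c.toAdd (f.toAdd 0) (f.toAdd 1) (f.toAdd 2) <| by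
      have hf : (![f.toAdd 0, f.toAdd 1, f.toAdd 2] : ZMod 3 → ZMod 3) = f.toAdd := by
        funext i
        fin_cases i <;> rfl
      rw [hf]
      exact congrArg Units.val h
    have hf : f = 1 := by
      apply Multiplicative.toAdd.injective
      funext i
      fin_cases i <;> assumption
    have hz' : z = 1 := hz
    have hc' : c = 1 := hc
    subst hf hz' hc'
    rfl
  exact fun x y h => hinj (Units.ext h)

lemma mem_Qgrp_iff (g : GL (Fin 2) (ZMod 9)) :
    g ∈ Qgrp ↔ ZMod.castHom (show (3 : ℕ) ∣ 9 by norm_num) (ZMod 3) (g.val 0 0) = 1 ∧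
      ZMod.castHom (show (3 : ℕ) ∣ 9 by norm_num) (ZMod 3) (g.val 1 0) = 0 ∧
      ZMod.castHom (show (3 : ℕ) ∣ 9 by norm_num) (ZMod 3) (g.val 1 1) = 1 :=
  Iff.rfl

lemma wreathProdToMatrix_mem_Qgrp
    (x : (Multiplicative (ZMod 3 → ZMod 3) ⋊[cyclicShift] Multiplicative (ZMod 3)) ×
      Multiplicative (ZMod 3)) :
    wreathProdToMatrix.toHomUnits x ∈ Qgrp := by
  have key : ∀ z : ZMod 3,
      ZMod.castHom (show (3 : ℕ) ∣ 9 by norm_num) (ZMod 3) (orderThreeMatrix z 0 0) = 1 ∧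
      ZMod.castHom (show (3 : ℕ) ∣ 9 by norm_num) (ZMod 3) (orderThreeMatrix z 1 0) = 0 ∧
      ZMod.castHom (show (3 : ℕ) ∣ 9 by norm_num) (ZMod 3) (orderThreeMatrix z 1 1) = 1 := by
    decide
  obtain ⟨h₀₀, h₁₀, h₁₁⟩ := key x.1.right.toAdd
  have hval : (wreathProdToMatrix.toHomUnits x).val = scalarUnit x.2.toAdd •
    (traceZeroMatrix x.1.left.toAdd * orderThreeMatrix x.1.right.toAdd) := rfl
  rw [mem_Qgrp_iff, hval]
  simp only [Matrix.smul_apply, Matrix.mul_apply, Fin.sum_univ_two, smul_eq_mul, map_mul,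
    map_add, h₀₀, h₁₀, h₁₁, traceZeroMatrix, scalarUnit, Matrix.of_apply, Matrix.cons_val',
    Matrix.cons_val_zero, Matrix.cons_val_one, castHom_threeMul, map_one]
  simp

lemma natCard_Qgrp_le : Nat.card Qgrp ≤ 243 := by
  let r := ZMod.castHom (show (3 : ℕ) ∣ 9 by norm_num) (ZMod 3)
  let entries (g : Qgrp) :
      {a : ZMod 9 // r a = 1} × ZMod 9 × {c : ZMod 9 // r c = 0} × {d : ZMod 9 // r d = 1} :=
    (⟨g.1.val 0 0, g.2.1⟩, g.1.val 0 1, ⟨g.1.val 1 0, g.2.2.1⟩, ⟨g.1.val 1 1, g.2.2.2⟩)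
  have hinj : Function.Injective entries := by
    intro g h hgh
    simp only [entries, Prod.mk.injEq] at hgh
    apply Subtype.ext
    apply Units.ext
    ext i j
    fin_cases i <;> fin_cases j
    exacts [congrArg Subtype.val hgh.1, hgh.2.1, congrArg Subtype.val hgh.2.2.1,
      congrArg Subtype.val hgh.2.2.2]
  refine (Nat.card_le_card_of_injective entries hinj).trans_eq ?_
  have h₁ : Fintype.card {a : ZMod 9 // r a = 1} = 3 := by decide
  have h₀ : Fintype.card {a : ZMod 9 // r a = 0} = 3 := by decide
  simp [Nat.card_eq_fintype_card, h₀, h₁]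

lemma natCard_wreathProd :
    Nat.card ((Multiplicative (ZMod 3 → ZMod 3) ⋊[cyclicShift] Multiplicative (ZMod 3)) ×
      Multiplicative (ZMod 3)) = 243 := by
  simp [Nat.card_prod, SemidirectProduct.card]

/-- The isomorphism from `(ℤ/3 ≀ ℤ/3) × ℤ/3` onto `Q`. -/
noncomputable def wreathProdEquivQgrp :
    ((Multiplicative (ZMod 3 → ZMod 3) ⋊[cyclicShift] Multiplicative (ZMod 3)) ×
      Multiplicative (ZMod 3)) ≃* Qgrp :=
  MulEquiv.ofBijective
    (wreathProdToMatrix.toHomUnits.codRestrict Qgrp wreathProdToMatrix_mem_Qgrp) <| by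
      refine Function.Injective.bijective_of_nat_card_le (fun x y h => ?_)
        (natCard_Qgrp_le.trans_eq natCard_wreathProd.symm)
      exact wreathProdToMatrix_injective (congrArg (fun g : Qgrp => g.1.val) h)

/-- The group `Q` of matrices in `GL₂(ℤ/9)` that are upper unitriangular mod 3 has order
`3⁵ = 243` and is isomorphic to `(ℤ/3 ≀ ℤ/3) × ℤ/3`, where the wreath product is
`(ℤ/3)³ ⋊ ℤ/3` with `ℤ/3` acting by cyclically permuting the coordinates. -/
theorem Qgrp_iso_wreath :
    Nat.card Qgrp = 243 ∧
      ∃ φ : Multiplicative (ZMod 3) →* MulAut (Multiplicative (ZMod 3 → ZMod 3)),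
        (∀ (z : ZMod 3) (f : ZMod 3 → ZMod 3),
          φ (Multiplicative.ofAdd z) (Multiplicative.ofAdd f) =
            Multiplicative.ofAdd (fun i => f (i + z))) ∧
        Nonempty (Qgrp ≃*
          ((Multiplicative (ZMod 3 → ZMod 3) ⋊[φ] Multiplicative (ZMod 3)) ×
            Multiplicative (ZMod 3))) := by
  exact ⟨(Nat.card_congr wreathProdEquivQgrp.toEquiv).symm.trans natCard_wreathProd,
    cyclicShift, fun _ _ => rfl, ⟨wreathProdEquivQgrp.symm⟩⟩
end
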